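/- If p_1 ≤ 2/3, then there exists an index i ∈ {1, …, n−1} such that min{σ1(i), σ2(i)} ≥ 1/3. -/

import Mathlib

/-- `sigma1 n p i` = total size of the `i` largest jobs (jobs `1,…,i`,
1-indexed; jobs are 0-indexed in `p`). -/
noncomputable def sigma1 (n : ℕ) (p : Fin n → ℝ) (i : ℕ) : ℝ :=
  ∑ j ∈ Finset.univ.filter (fun j : Fin n => (j : ℕ) < i), p j

/-- `sigma2 n p i` = total size of the remaining jobs `i+1,…,n` (1-indexed). -/
noncomputable def sigma2 (n : ℕ) (p : Fin n → ℝ) (i : ℕ) : ℝ :=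
  ∑ j ∈ Finset.univ.filter (fun j : Fin n => i ≤ (j : ℕ)), p j

theorem sigma1_succ_aux (n : ℕ) (p : Fin n → ℝ) (i : ℕ) (h : i < n) :
    sigma1 n p (i + 1) = sigma1 n p i + p ⟨i, h⟩ := by
  unfold sigma1
  have : Finset.univ.filter (fun j : Fin n => (j : ℕ) < i + 1)
      = insert ⟨i, h⟩ (Finset.univ.filter (fun j : Fin n => (j : ℕ) < i)) := by
    ext j
    simp [Fin.ext_iff]
    omega
  rw [this, Finset.sum_insert (by simp), add_comm]

/-- if the largest job has size at most `2/3`, then some split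
index `i ∈ {1,…,n−1}` satisfies `min{σ1(i), σ2(i)} ≥ 1/3`. -/
theorem stmt10 (n : ℕ) (hn : 2 ≤ n) (p : Fin n → ℝ)
    (hp : ∀ j, 0 < p j) (hsort : ∀ i j : Fin n, i ≤ j → p j ≤ p i)
    (hsum : ∑ j, p j = 1)
    (hp1 : p ⟨0, by omega⟩ ≤ 2 / 3) :
    ∃ i, 1 ≤ i ∧ i ≤ n - 1 ∧ 1 / 3 ≤ min (sigma1 n p i) (sigma2 n p i) := by
  classical
  have h0 : sigma1 n p 0 = 0 := by simp [sigma1]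
  have hN : sigma1 n p n = 1 := by simp [sigma1, hsum]
  have hadd : ∀ i, sigma1 n p i + sigma2 n p i = 1 := by
    intro i
    rw [← hsum, ← Finset.sum_filter_add_sum_filter_not Finset.univ (fun j : Fin n => (j : ℕ) < i)]
    simp [sigma1, sigma2]
  have hex : ∃ i, 1 / 3 ≤ sigma1 n p i := ⟨n, by rw [hN]; norm_num⟩
  obtain ⟨i, hi, hmin⟩ : ∃ i, 1 / 3 ≤ sigma1 n p i ∧ ∀ m < i, sigma1 n p m < 1 / 3 :=
    ⟨Nat.find hex, Nat.find_spec hex, fun m hm => not_le.mp (Nat.find_min hex hm)⟩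
  have hin : i ≤ n := by
    by_contra hc
    have := hmin n (by omega)
    rw [hN] at this
    norm_num at this
  have hle : sigma1 n p i ≤ 2 / 3 := by
    rcases i with _ | k
    · rw [h0]; norm_num
    · rw [sigma1_succ_aux n p k (by omega)]
      rcases Nat.eq_zero_or_pos k with rfl | hk
      · rw [h0]; linarith
      · have h1 := hmin k (by omega)
        have h2 := hsort ⟨0, by omega⟩ ⟨k, by omega⟩ (by simp [Fin.le_def])
        have h3 := Finset.single_le_sum
          (s := Finset.univ.filter (fun j : Fin n => (j : ℕ) < k)) (f := p)
          (fun j _ => (hp j).le) (a := ⟨0, by omega⟩) (by simpa using hk)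
        have h4 : p ⟨0, by omega⟩ ≤ sigma1 n p k := h3
        linarith
  refine ⟨i, ?_, ?_, le_min hi ?_⟩
  · by_contra hc
    have : i = 0 := by omega
    rw [this, h0] at hi
    norm_num at hi
  · by_contra hc
    have : i = n := by omega
    rw [this, hN] at hle
    norm_num at hle
  · linarith [hadd i]
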